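/- arXiv:1301.4574 — 2 statements merged into one kernel-verified Lean document; each statement's English description precedes it below -/
import Mathlib

section
/- Let Γ be a nonempty set and 𝕂 ∈ {ℝ, ℂ}. Let T : ℓ₁(Γ, 𝕂) → ℓ₁(Γ, 𝕂) be a bounded linear operator with ‖T‖ = 1, let 0 < ε < 1, and let (x, φ) ∈ Π(ℓ₁(Γ, 𝕂)) be such that Re(φ(Tx)) ≥ 1 − (ε/9)^{9/2}. Then there exist a bounded linear operator T₀ on ℓ₁(Γ, 𝕂) with ‖T₀‖ = 1 and a pair (x₀, φ₀) ∈ Π(ℓ₁(Γ, 𝕂)) such that ‖T − T₀‖ ≤ ε, ‖x − x₀‖ ≤ ε, ‖φ − φ₀‖ ≤ ε, and φ₀(T₀ x₀) = 1. -/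
open scoped ENNReal

namespace LpOne

variable {Γ 𝕂 E : Type*} [RCLike 𝕂] [NormedAddCommGroup E] [NormedSpace 𝕂 E]

theorem hasSum_norm (y : lp (fun _ : Γ => 𝕂) 1) : HasSum (fun γ => ‖y γ‖) ‖y‖ := by
  simpa using lp.hasSum_norm (p := 1) (by simp) y

theorem norm_le_of_hasSum (y : lp (fun _ : Γ => 𝕂) 1) {b : Γ → ℝ} {B : ℝ} (hb : HasSum b B)
    (h : ∀ γ, ‖y γ‖ ≤ b γ) : ‖y‖ ≤ B :=
  hasSum_le h (hasSum_norm y) hb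

/-- A family dominated in norm by an element of `ℓ₁` is itself an element of `ℓ₁`. -/
theorem exists_coe_eq (y : lp (fun _ : Γ => 𝕂) 1) (f : Γ → 𝕂) (h : ∀ γ, ‖f γ‖ ≤ ‖y γ‖) :
    ∃ z : lp (fun _ : Γ => 𝕂) 1, ∀ γ, z γ = f γ := by
  have hf : Memℓp f 1 := memℓp_gen (by
    simpa using Summable.of_nonneg_of_le (fun _ => norm_nonneg _) h (hasSum_norm y).summable)
  exact ⟨⟨f, hf⟩, fun _ => rfl⟩

theorem hasSum_apply [DecidableEq Γ] (A : lp (fun _ : Γ => 𝕂) 1 →L[𝕂] E)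
    (y : lp (fun _ : Γ => 𝕂) 1) : HasSum (fun γ => y γ • A (lp.single 1 γ 1)) (A y) := by
  convert (lp.hasSum_single ENNReal.one_ne_top y).mapL A using 2 with γ
  rw [← map_smul, ← lp.single_smul]
  simp

theorem opNorm_le_of_single [DecidableEq Γ] (A : lp (fun _ : Γ => 𝕂) 1 →L[𝕂] E) {C : ℝ}
    (hC : 0 ≤ C) (h : ∀ γ, ‖A (lp.single 1 γ 1)‖ ≤ C) : ‖A‖ ≤ C := by
  refine A.opNorm_le_bound hC fun y => ?_
  rw [mul_comm, ← (hasSum_apply A y).tsum_eq]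
  refine tsum_of_norm_bounded ((hasSum_norm y).mul_right C) fun γ => ?_
  rw [norm_smul]
  gcongr
  exact h γ

/-- Operators on `ℓ₁` are exactly given by bounded families of columns. -/
theorem exists_clm_of_columns [CompleteSpace E] [DecidableEq Γ] (c : Γ → E) {K : ℝ} (hK : 0 ≤ K)
    (hc : ∀ γ, ‖c γ‖ ≤ K) :
    ∃ A : lp (fun _ : Γ => 𝕂) 1 →L[𝕂] E, ‖A‖ ≤ K ∧ ∀ γ, A (lp.single 1 γ 1) = c γ := by
  have hb : ∀ γ, ‖ContinuousLinearMap.toSpanSingleton 𝕂 (c γ)‖ ≤ K := fun γ => by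
    simpa using hc γ
  let A := (lp.tsumCLM 𝕂 Γ E).comp
    (lp.mapCLM 1 (fun γ => ContinuousLinearMap.toSpanSingleton 𝕂 (c γ)) hK hb)
  have hA : ∀ γ, A (lp.single 1 γ 1) = c γ := fun γ => by
    change ∑' η, (lp.single 1 γ (1 : 𝕂) : lp (fun _ : Γ => 𝕂) 1) η • c η = c γ
    rw [tsum_eq_single γ fun η hη => by simp [lp.single_apply, hη]]
    simp
  exact ⟨A, opNorm_le_of_single A hK fun γ => by simpa [hA] using hc γ, hA⟩

theorem apply_eq_mul_norm [DecidableEq Γ] (g : lp (fun _ : Γ => 𝕂) 1 →L[𝕂] 𝕂)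
    {y : lp (fun _ : Γ => 𝕂) 1} {θ : 𝕂}
    (h : ∀ η, y η * g (lp.single 1 η 1) = θ * ‖y η‖) : g y = θ * ‖y‖ := by
  have h1 := hasSum_apply g y
  simp only [smul_eq_mul, h] at h1
  exact h1.unique (((RCLike.hasSum_ofReal 𝕂).2 (hasSum_norm y)).mul_left θ)

/-- A vector on which `g` already attains `θ * ‖y‖` can be completed at a single coordinate to a
vector of the unit ball on which `g` takes the value `θ`. -/
theorem exists_completion [DecidableEq Γ] (g : lp (fun _ : Γ => 𝕂) 1 →L[𝕂] 𝕂)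
    {y : lp (fun _ : Γ => 𝕂) 1} (hy : ‖y‖ ≤ 1) {θ : 𝕂} (hθ : ‖θ‖ = 1) (hgy : g y = θ * ‖y‖)
    {γ : Γ} (hγ : ‖g (lp.single 1 γ 1)‖ = 1) :
    ∃ a : 𝕂, ‖a‖ = 1 - ‖y‖ ∧ ‖y + lp.single 1 γ a‖ ≤ 1 ∧ g (y + lp.single 1 γ a) = θ := by
  set n := g (lp.single 1 γ 1) with hn
  have h0 : (0 : ℝ) ≤ 1 - ‖y‖ := by linarith
  obtain ⟨a, hadef⟩ : ∃ a : 𝕂, a = ((1 - ‖y‖ : ℝ) : 𝕂) * (θ * (starRingEnd 𝕂) n) := ⟨_, rfl⟩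
  have ha : ‖a‖ = 1 - ‖y‖ := by
    simp only [hadef, norm_mul, RCLike.norm_conj, hθ, hγ, RCLike.norm_ofReal, abs_of_nonneg h0]
    ring
  have hs : g (lp.single 1 γ a) = a * n := by
    have : (lp.single 1 γ a : lp (fun _ : Γ => 𝕂) 1) = a • lp.single 1 γ 1 := by
      rw [← lp.single_smul]; simp
    rw [this, map_smul, smul_eq_mul, hn]
  have hnn : (starRingEnd 𝕂) n * n = 1 := by rw [RCLike.conj_mul, hγ]; simp
  refine ⟨a, ha, ?_, ?_⟩
  · refine (norm_add_le _ _).trans_eq ?_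
    rw [lp.norm_single (by simp), ha]
    ring
  · rw [map_add, hgy, hs]
    rw [hadef]
    push_cast
    linear_combination (1 - (‖y‖ : 𝕂)) * θ * hnn

end LpOne

/-- If `l * re u` is close to `‖u‖` for some `l` in `[1/2, 1]`, then `u` is close to `‖u‖`. -/
theorem RCLike.norm_sub_norm_le {𝕂 : Type*} [RCLike 𝕂] (u : 𝕂) {l q : ℝ} (hl : 1 / 2 ≤ l)
    (hl1 : l ≤ 1) (hq : 0 < q) :
    ‖u - (‖u‖ : 𝕂)‖ ≤ q * ‖u‖ + (‖u‖ - l * RCLike.re u) / q := by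
  have h1 : RCLike.re u ≤ ‖u‖ := RCLike.re_le_norm u
  have h0 := norm_nonneg u
  have hw : ‖u‖ - RCLike.re u ≤ 2 * (‖u‖ - l * RCLike.re u) := by
    nlinarith [mul_nonneg (by linarith : 0 ≤ l - 1 / 2) (sub_nonneg.2 h1)]
  set w := ‖u‖ - l * RCLike.re u with hwdef
  have hw0 : 0 ≤ w := by linarith
  refine abs_le_of_sq_le_sq' ?_ (by positivity) |>.2
  have hsq : ‖u - (‖u‖ : 𝕂)‖ ^ 2 = 2 * ‖u‖ * (‖u‖ - RCLike.re u) := by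
    have h2 := RCLike.norm_sq_eq_def (z := u - (‖u‖ : 𝕂))
    have h3 := RCLike.norm_sq_eq_def (z := u)
    simp only [map_sub, RCLike.ofReal_re, RCLike.ofReal_im] at h2
    rw [h2]
    linear_combination -h3
  rw [hsq]
  have h4 : (q * ‖u‖ + w / q) ^ 2 = (q * ‖u‖ - w / q) ^ 2 + 4 * ‖u‖ * w := by
    field_simp; ring
  nlinarith [sq_nonneg (q * ‖u‖ - w / q), mul_le_mul_of_nonneg_left hw h0]

/-- Entries of modulus at least `1 - q` can be pushed to the unit circle. -/
theorem RCLike.exists_norm_le_one_near {𝕂 : Type*} [RCLike 𝕂] {z : 𝕂} {q : ℝ} (hz : ‖z‖ ≤ 1)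
    (hq : 0 < q) (hq1 : q < 1) :
    ∃ ν : 𝕂, ‖ν‖ ≤ 1 ∧ ‖z - ν‖ ≤ q ∧ (1 - q ≤ ‖z‖ → ‖ν‖ = 1 ∧ z = ‖z‖ * ν) := by
  by_cases h : 1 - q ≤ ‖z‖
  · have hpos : 0 < ‖z‖ := by linarith
    have hz0 : (‖z‖ : 𝕂) ≠ 0 := by exact_mod_cast hpos.ne'
    have hν : ‖(‖z‖ : 𝕂)⁻¹ * z‖ = 1 := by
      rw [norm_mul, norm_inv, RCLike.norm_ofReal, abs_of_pos hpos, inv_mul_cancel₀ hpos.ne']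
    have hzν : z = ‖z‖ * ((‖z‖ : 𝕂)⁻¹ * z) := by field_simp
    refine ⟨(‖z‖ : 𝕂)⁻¹ * z, hν.le, ?_, fun _ => ⟨hν, hzν⟩⟩
    have : z - (‖z‖ : 𝕂)⁻¹ * z = ((‖z‖ - 1 : ℝ) : 𝕂) * ((‖z‖ : 𝕂)⁻¹ * z) := by
      push_cast; linear_combination hzν
    rw [this, norm_mul, hν, RCLike.norm_ofReal, mul_one, abs_le]
    constructor <;> linarith
  · exact ⟨z, hz, by simpa using hq.le, fun h' => absurd h' h⟩

namespace LpOne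

variable {Γ 𝕂 : Type*} [RCLike 𝕂]

/-- A vector `t` of the unit ball on which `f` is almost `θ` is close to a vector of the unit ball
on which the modified functional `g` is exactly `θ`. -/
theorem exists_column [DecidableEq Γ] (f g : lp (fun _ : Γ => 𝕂) 1 →L[𝕂] 𝕂) {q r : ℝ}
    (hq : 0 < q) (hq2 : q ≤ 1 / 2)
    (hf : ∀ γ, ‖f (lp.single 1 γ 1)‖ ≤ 1)
    (hg : ∀ γ, 1 - q ≤ ‖f (lp.single 1 γ 1)‖ → ‖g (lp.single 1 γ 1)‖ = 1 ∧
      f (lp.single 1 γ 1) = ‖f (lp.single 1 γ 1)‖ * g (lp.single 1 γ 1))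
    {γ : Γ} (hγ : ‖g (lp.single 1 γ 1)‖ = 1) {θ : 𝕂} (hθ : ‖θ‖ = 1)
    {t : lp (fun _ : Γ => 𝕂) 1} (ht : ‖t‖ ≤ 1)
    (hft : 1 - r ≤ RCLike.re ((starRingEnd 𝕂) θ * f t)) :
    ∃ s : lp (fun _ : Γ => 𝕂) 1, ‖s‖ ≤ 1 ∧ g s = θ ∧ ‖t - s‖ ≤ 2 * (q + r / q) + r := by
  classical
  set F := fun η => f (lp.single 1 η 1)
  set G := fun η => g (lp.single 1 η 1)
  replace hg : ∀ η, 1 - q ≤ ‖F η‖ → ‖G η‖ = 1 ∧ F η = ‖F η‖ * G η := hg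
  have hFt : HasSum (fun η => t η * F η) (f t) := by simpa using hasSum_apply f t
  set w := fun η => ‖t η‖ - RCLike.re ((starRingEnd 𝕂) θ * (t η * F η)) with hw
  have hwsum : HasSum w (‖t‖ - RCLike.re ((starRingEnd 𝕂) θ * f t)) :=
    (hasSum_norm t).sub ((RCLike.reCLM).hasSum (hFt.mul_left _))
  have hle : ∀ η, ‖(starRingEnd 𝕂) θ * (t η * F η)‖ ≤ ‖t η‖ * ‖F η‖ := fun η => by
    simp [hθ]
  have hft' : RCLike.re ((starRingEnd 𝕂) θ * f t) ≤ ‖t‖ := by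
    refine sub_nonneg.1 (hwsum.nonneg fun η => sub_nonneg.2 ?_)
    refine (RCLike.re_le_norm _).trans ((hle η).trans ?_)
    exact mul_le_of_le_one_right (norm_nonneg _) (hf η)
  obtain ⟨y, hy⟩ := exists_coe_eq t
    (fun η => if 1 - q ≤ ‖F η‖ then θ * (starRingEnd 𝕂) (G η) * ‖t η‖ else 0) (fun η => by
      split_ifs with h
      · simp [hθ, (hg η h).1]
      · simp)
  have hyt : ∀ η, ‖y η‖ ≤ ‖t η‖ := fun η => by
    rw [hy]
    split_ifs with h
    · simp [hθ, (hg η h).1]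
    · simp
  have hy1 : ‖y‖ ≤ 1 := (norm_le_of_hasSum y (hasSum_norm t) hyt).trans ht
  have hgy : g y = θ * ‖y‖ := by
    refine apply_eq_mul_norm g fun η => ?_
    change y η * G η = _
    rw [hy]
    split_ifs with h
    · have hGG : (starRingEnd 𝕂) (G η) * G η = 1 := by
        rw [RCLike.conj_mul, (hg η h).1]; simp
      simp only [norm_mul, RCLike.norm_conj, hθ, (hg η h).1, RCLike.norm_ofReal, abs_norm, one_mul]
      linear_combination θ * ‖t η‖ * hGG
    · simp
  have hdist : ‖t - y‖ ≤ q + r / q := by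
    have h1 := norm_le_of_hasSum (t - y) (((hasSum_norm t).mul_left q).add (hwsum.div_const q))
      (fun η => by
        rw [lp.coeFn_sub, Pi.sub_apply, hy]
        split_ifs with h
        · obtain ⟨hG1, hFG⟩ := hg η h
          set u := (starRingEnd 𝕂) θ * G η * t η with hu
          have hun : ‖u‖ = ‖t η‖ := by simp [hu, hθ, G, hG1]
          have hwu : w η = ‖u‖ - ‖F η‖ * RCLike.re u := by
            rw [hun, ← RCLike.re_ofReal_mul]
            simp only [hw]
            congr 2
            rw [hu]
            linear_combination (starRingEnd 𝕂) θ * t η * hFG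
          have huu : ‖t η - θ * (starRingEnd 𝕂) (G η) * ‖t η‖‖ = ‖u - (‖u‖ : 𝕂)‖ := by
            have hGG : (starRingEnd 𝕂) (G η) * G η = 1 := by rw [RCLike.conj_mul, hG1]; simp
            have hθθ : (starRingEnd 𝕂) θ * θ = 1 := by rw [RCLike.conj_mul, hθ]; simp
            have : u - (‖u‖ : 𝕂) = (starRingEnd 𝕂) θ * G η *
                (t η - θ * (starRingEnd 𝕂) (G η) * ‖t η‖) := by
              rw [hun, hu]
              linear_combination (‖t η‖ : 𝕂) * hθθ * ((starRingEnd 𝕂) (G η) * G η)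
                + (‖t η‖ : 𝕂) * hGG
            rw [this, norm_mul, norm_mul, RCLike.norm_conj, hθ, hG1]
            simp
          rw [huu, ← hun, hwu]
          exact RCLike.norm_sub_norm_le u (by linarith) (hf η) hq
        · have h2 : q * ‖t η‖ ≤ w η := by
            have h3 := (RCLike.re_le_norm _).trans (hle η)
            have h4 : ‖t η‖ * ‖F η‖ ≤ ‖t η‖ * (1 - q) := by
              gcongr; exact (not_le.1 h).le
            simp only [hw]
            linarith
          have h3 : ‖t η‖ ≤ w η / q := by rw [le_div_iff₀ hq]; linarith
          have h4 : 0 ≤ q * ‖t η‖ := by positivity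
          rw [sub_zero]
          linarith)
    have h2 : (‖t‖ - RCLike.re ((starRingEnd 𝕂) θ * f t)) / q ≤ r / q := by
      gcongr; linarith
    nlinarith
  obtain ⟨a, ha, hn, hga⟩ := exists_completion g hy1 hθ hgy hγ
  refine ⟨_, hn, hga, ?_⟩
  have h1 : ‖t - (y + lp.single 1 γ a)‖ ≤ ‖t - y‖ + ‖a‖ := by
    rw [← sub_sub]
    refine (norm_sub_le _ _).trans_eq ?_
    rw [lp.norm_single (by simp)]
  have h2 : ‖t‖ ≤ ‖t - y‖ + ‖y‖ := by simpa using norm_add_le (t - y) y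
  linarith

/-- If `f x = 1 = ‖x‖`, then `f` is unimodular on the support of `x`, with the opposite phase. -/
theorem mul_apply_single_eq_norm [DecidableEq Γ] (f : lp (fun _ : Γ => 𝕂) 1 →L[𝕂] 𝕂)
    (hf : ∀ γ, ‖f (lp.single 1 γ 1)‖ ≤ 1) {x : lp (fun _ : Γ => 𝕂) 1} (hx : ‖x‖ = 1)
    (hfx : f x = 1) (γ : Γ) : x γ * f (lp.single 1 γ 1) = ‖x γ‖ := by
  have hle : ∀ γ, ‖x γ * f (lp.single 1 γ 1)‖ ≤ ‖x γ‖ := fun γ => by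
    rw [norm_mul]
    exact mul_le_of_le_one_right (norm_nonneg _) (hf γ)
  have hs : HasSum (fun γ => ‖x γ‖ - RCLike.re (x γ * f (lp.single 1 γ 1))) 0 := by
    have := (hasSum_norm x).sub (RCLike.reCLM.hasSum (hasSum_apply f x))
    simpa [hx, hfx] using this
  have h0 := congrFun ((hasSum_zero_iff_of_nonneg fun γ =>
    sub_nonneg.2 ((RCLike.re_le_norm _).trans (hle γ))).1 hs) γ
  have h1 : ‖x γ‖ = RCLike.re (x γ * f (lp.single 1 γ 1)) := sub_eq_zero.1 h0
  have h2 := RCLike.norm_le_re_iff_eq_norm.1 ((hle γ).trans_eq h1)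
  rw [h2]
  congr 1
  exact le_antisymm (hle γ) (h1.trans_le (RCLike.re_le_norm _))

/-- A unit vector almost attaining `h` is close to a vector supported on the coordinates where `h`
is almost `f`. -/
theorem exists_vector [DecidableEq Γ] (f g h : lp (fun _ : Γ => 𝕂) 1 →L[𝕂] 𝕂) {δ r : ℝ}
    (hr : 0 < r) (hδr : δ < r) (hf : ∀ γ, ‖f (lp.single 1 γ 1)‖ ≤ 1)
    (hh : ∀ γ, ‖h (lp.single 1 γ 1)‖ ≤ 1)
    (hfg : ∀ γ, ‖f (lp.single 1 γ 1)‖ = 1 → g (lp.single 1 γ 1) = f (lp.single 1 γ 1))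
    {x : lp (fun _ : Γ => 𝕂) 1} (hx : ‖x‖ = 1) (hfx : f x = 1)
    (hhx : 1 - δ ≤ RCLike.re (h x)) :
    ∃ x₀ : lp (fun _ : Γ => 𝕂) 1, ‖x₀‖ ≤ 1 ∧ g x₀ = 1 ∧ ‖x - x₀‖ ≤ 2 * (δ / r) ∧
      ∀ γ, x₀ γ ≠ 0 → ‖f (lp.single 1 γ 1)‖ = 1 ∧
        1 - r ≤ RCLike.re ((starRingEnd 𝕂) (f (lp.single 1 γ 1)) * h (lp.single 1 γ 1)) := by
  classical
  have hxf := mul_apply_single_eq_norm f hf hx hfx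
  set w := fun γ => ‖x γ‖ - RCLike.re (x γ * h (lp.single 1 γ 1)) with hw
  have hw0 : ∀ γ, 0 ≤ w γ := fun γ => sub_nonneg.2 <| (RCLike.re_le_norm _).trans <| by
    rw [norm_mul]
    exact mul_le_of_le_one_right (norm_nonneg _) (hh γ)
  have hwsum : HasSum w (1 - RCLike.re (h x)) := by
    have := (hasSum_norm x).sub (RCLike.reCLM.hasSum (hasSum_apply h x))
    rwa [hx] at this
  obtain ⟨y, hy⟩ := exists_coe_eq x
    (fun γ => if x γ ≠ 0 ∧ w γ ≤ r * ‖x γ‖ then x γ else 0) (fun γ => by split_ifs <;> simp)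
  have hf1 : ∀ γ, x γ ≠ 0 → ‖f (lp.single 1 γ 1)‖ = 1 := fun γ hγ => by
    have := congrArg norm (hxf γ)
    rw [norm_mul, RCLike.norm_ofReal, abs_norm] at this
    exact mul_left_cancel₀ (norm_ne_zero_iff.2 hγ) (this.trans (mul_one _).symm)
  have hP : ∀ γ, y γ ≠ 0 → ‖f (lp.single 1 γ 1)‖ = 1 ∧
      1 - r ≤ RCLike.re ((starRingEnd 𝕂) (f (lp.single 1 γ 1)) * h (lp.single 1 γ 1)) := by
    intro γ hγ
    rw [hy] at hγ
    obtain ⟨hγ0, hγw⟩ : x γ ≠ 0 ∧ w γ ≤ r * ‖x γ‖ := by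
      by_contra hc
      exact hγ (if_neg hc)
    refine ⟨hf1 γ hγ0, ?_⟩
    have hxγ : x γ = (‖x γ‖ : 𝕂) * (starRingEnd 𝕂) (f (lp.single 1 γ 1)) := by
      have h1 : f (lp.single 1 γ 1) * (starRingEnd 𝕂) (f (lp.single 1 γ 1)) = 1 := by
        rw [RCLike.mul_conj, hf1 γ hγ0]; simp
      linear_combination (starRingEnd 𝕂) (f (lp.single 1 γ 1)) * hxf γ - x γ * h1
    have h2 : RCLike.re (x γ * h (lp.single 1 γ 1)) =
        ‖x γ‖ * RCLike.re ((starRingEnd 𝕂) (f (lp.single 1 γ 1)) * h (lp.single 1 γ 1)) := by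
      rw [← RCLike.re_ofReal_mul, ← mul_assoc, ← hxγ]
    have h3 : 0 < ‖x γ‖ := norm_pos_iff.2 hγ0
    simp only [hw, h2] at hγw
    refine le_of_mul_le_mul_left ?_ h3
    linarith
  have hy1 : ‖y‖ ≤ 1 := by
    refine (norm_le_of_hasSum y (hasSum_norm x) fun γ => ?_).trans hx.le
    rw [hy]
    split_ifs <;> simp
  have hgy : g y = 1 * ‖y‖ := by
    refine apply_eq_mul_norm g fun γ => ?_
    by_cases hγ : y γ = 0
    · simp [hγ]
    · rw [hfg γ (hP γ hγ).1, one_mul]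
      have : y γ = x γ := by
        rw [hy] at hγ ⊢
        exact if_pos (by by_contra hc; exact hγ (if_neg hc))
      rw [this, hxf]
  have hdist : ‖x - y‖ ≤ δ / r := by
    refine (norm_le_of_hasSum (x - y) (hwsum.div_const r) fun γ => ?_).trans ?_
    · rw [lp.coeFn_sub, Pi.sub_apply, hy]
      split_ifs with hc
      · simpa using div_nonneg (hw0 γ) hr.le
      · rw [sub_zero, le_div_iff₀ hr]
        by_cases hγ : x γ = 0
        · simpa [hγ] using hw0 γ
        · have : ¬ w γ ≤ r * ‖x γ‖ := fun h' => hc ⟨hγ, h'⟩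
          linarith
    · gcongr; linarith
  have hxy : ‖x‖ ≤ ‖x - y‖ + ‖y‖ := by simpa using norm_add_le (x - y) y
  obtain ⟨γ, hγ⟩ : ∃ γ, y γ ≠ 0 := by
    by_contra! hc
    have hy0 : y = 0 := lp.ext (funext hc)
    have : δ / r < 1 := (div_lt_one hr).2 hδr
    rw [hy0, norm_zero] at hxy
    rw [hy0] at hdist
    linarith
  obtain ⟨a, ha, hn, hga⟩ := exists_completion g hy1 norm_one hgy
    ((congrArg norm (hfg γ (hP γ hγ).1)).trans (hP γ hγ).1)
  refine ⟨_, hn, hga, ?_, fun η hη => hP η fun h0 => hη ?_⟩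
  · have h1 : ‖x - (y + lp.single 1 γ a)‖ ≤ ‖x - y‖ + ‖a‖ := by
      rw [← sub_sub]
      refine (norm_sub_le _ _).trans_eq ?_
      rw [lp.norm_single (by simp)]
    linarith
  · have hne : η ≠ γ := fun h' => hγ (h' ▸ h0)
    simp [h0, lp.single_apply, hne]

end LpOne

/-- Bishop–Phelps–Bollobás type theorem for numerical radius on `ℓ₁(Γ, 𝕂)`,
`𝕂 ∈ {ℝ, ℂ}`: if `‖T‖ = 1`, `(x, φ) ∈ Π(ℓ₁(Γ, 𝕂))` and
`Re(φ(Tx)) ≥ 1 - (ε/9)^{9/2}`, then there are `T₀` with `‖T₀‖ = 1` and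
`(x₀, φ₀) ∈ Π(ℓ₁(Γ, 𝕂))` with `‖T - T₀‖ ≤ ε`, `‖x - x₀‖ ≤ ε`, `‖φ - φ₀‖ ≤ ε`
and `φ₀(T₀x₀) = 1`.  The dual of `ℓ₁(Γ, 𝕂)` is identified with `ℓ∞(Γ, 𝕂)`
acting by `φ(x) = ∑_{γ ∈ Γ} φ(γ) x(γ)`. -/
theorem bpb_numerical_radius_l1_general
    (Γ : Type*) [Nonempty Γ] (𝕂 : Type*) [RCLike 𝕂]
    (T : lp (fun _ : Γ => 𝕂) 1 →L[𝕂] lp (fun _ : Γ => 𝕂) 1) (hT : ‖T‖ = 1)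
    (ε : ℝ) (hε0 : 0 < ε) (hε1 : ε < 1)
    (x : lp (fun _ : Γ => 𝕂) 1) (φ : lp (fun _ : Γ => 𝕂) ∞)
    (hx : ‖x‖ = 1) (hφ : ‖φ‖ = 1) (hxφ : (∑' γ : Γ, φ γ * x γ) = 1)
    (hnum : 1 - (ε / 9) ^ ((9 : ℝ) / 2) ≤ RCLike.re (∑' γ : Γ, φ γ * (T x) γ)) :
    ∃ (T₀ : lp (fun _ : Γ => 𝕂) 1 →L[𝕂] lp (fun _ : Γ => 𝕂) 1)
      (x₀ : lp (fun _ : Γ => 𝕂) 1) (φ₀ : lp (fun _ : Γ => 𝕂) ∞),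
      ‖T₀‖ = 1 ∧ ‖x₀‖ = 1 ∧ ‖φ₀‖ = 1 ∧ (∑' γ : Γ, φ₀ γ * x₀ γ) = 1 ∧
      ‖T - T₀‖ ≤ ε ∧ ‖x - x₀‖ ≤ ε ∧ ‖φ - φ₀‖ ≤ ε ∧
      (∑' γ : Γ, φ₀ γ * (T₀ x₀) γ) = 1 := by
  classical
  set q := ε / 9 with hqdef
  have hq : 0 < q := by positivity
  have hq9 : q < 1 / 9 := by linarith
  have hδ : q ^ ((9 : ℝ) / 2) ≤ q ^ 4 := by
    rw [← Real.rpow_natCast]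
    exact Real.rpow_le_rpow_of_exponent_ge hq (by linarith) (by norm_num)
  have hφ1 : ∀ γ, ‖φ γ‖ ≤ 1 := fun γ => (lp.norm_apply_le_norm (by simp) φ γ).trans_eq hφ
  have he : ∀ γ, ‖(lp.single 1 γ 1 : lp (fun _ : Γ => 𝕂) 1)‖ = 1 := fun γ => by
    rw [lp.norm_single (by simp), norm_one]
  choose ν hν1 hν hνφ using fun γ =>
    RCLike.exists_norm_le_one_near (hφ1 γ) hq (by linarith : q < 1)
  obtain ⟨f, -, hf⟩ := LpOne.exists_clm_of_columns (𝕂 := 𝕂) φ zero_le_one hφ1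
  obtain ⟨g, hg1, hg⟩ := LpOne.exists_clm_of_columns (𝕂 := 𝕂) ν zero_le_one hν1
  have hf_apply : ∀ y, f y = ∑' γ, φ γ * y γ := fun y => by
    simpa [hf, mul_comm] using (LpOne.hasSum_apply f y).tsum_eq.symm
  have hg_apply : ∀ y, g y = ∑' γ, ν γ * y γ := fun y => by
    simpa [hg, mul_comm] using (LpOne.hasSum_apply g y).tsum_eq.symm
  have hφν : ∀ γ, ‖φ γ‖ = 1 → ν γ = φ γ := fun γ hγ => by
    simpa [hγ] using (hνφ γ (by linarith)).2.symm
  have hTe : ∀ γ, ‖T (lp.single 1 γ 1)‖ ≤ 1 := fun γ => by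
    simpa [hT, he] using T.le_opNorm (lp.single 1 γ 1)
  have hfT : ∀ γ, ‖(f.comp T) (lp.single 1 γ 1)‖ ≤ 1 := fun γ => by
    have hf1 : ‖f‖ ≤ 1 := LpOne.opNorm_le_of_single f zero_le_one (by simpa [hf] using hφ1)
    refine (f.le_opNorm _).trans (mul_le_one₀ hf1 (norm_nonneg _) (hTe γ))
  obtain ⟨x₀, hx₀, hgx₀, hxx₀, hsupp⟩ := LpOne.exists_vector f g (f.comp T)
    (δ := q ^ 4) (r := q ^ 3) (by positivity)
    (by nlinarith [pow_pos hq 3]) (by simpa [hf] using hφ1) hfT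
    (by simpa [hf, hg] using hφν) hx (by rw [hf_apply, hxφ])
    (by rw [ContinuousLinearMap.comp_apply, hf_apply]; linarith)
  have hcol : ∀ γ, ∃ s : lp (fun _ : Γ => 𝕂) 1, ‖s‖ ≤ 1 ∧ ‖T (lp.single 1 γ 1) - s‖ ≤ ε ∧
      (x₀ γ ≠ 0 → g s = ν γ) := by
    intro γ
    by_cases hγ : x₀ γ = 0
    · exact ⟨_, hTe γ, by simpa using hε0.le, fun h => absurd hγ h⟩
    · obtain ⟨h1, h2⟩ := hsupp γ hγ
      rw [hf] at h1
      have h3 := hφν γ h1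
      obtain ⟨s, hs, hgs, hTs⟩ := LpOne.exists_column f g hq (by linarith)
        (by simpa [hf] using hφ1) (by simpa [hf, hg] using hνφ)
        (γ := γ) (by rw [hg, h3, h1]) (θ := φ γ) h1 (hTe γ) (r := q ^ 3) (by simpa [hf] using h2)
      refine ⟨s, hs, hTs.trans ?_, fun _ => hgs.trans h3.symm⟩
      have h4 : q ^ 3 / q = q ^ 2 := by field_simp
      have h5 : q ^ 2 ≤ q := by nlinarith
      have h6 : q ^ 3 ≤ q := by nlinarith
      rw [h4]
      linarith
  choose s hs hTs hgs using hcol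
  obtain ⟨T₀, hT₀, hT₀s⟩ := LpOne.exists_clm_of_columns (𝕂 := 𝕂) s zero_le_one hs
  have hgT₀ : g (T₀ x₀) = 1 := by
    rw [← hgx₀]
    refine (LpOne.hasSum_apply (g.comp T₀) x₀).unique ?_
    convert LpOne.hasSum_apply g x₀ using 2 with γ
    by_cases hγ : x₀ γ = 0
    · simp [hγ]
    · rw [ContinuousLinearMap.comp_apply, hT₀s, hgs γ hγ, hg]
  obtain ⟨φ₀, hφ₀⟩ : ∃ φ₀ : lp (fun _ : Γ => 𝕂) ∞, ∀ γ, φ₀ γ = ν γ :=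
    ⟨⟨ν, memℓp_infty ⟨1, by rintro _ ⟨γ, rfl⟩; exact hν1 γ⟩⟩, fun _ => rfl⟩
  have hx₀1 : ‖x₀‖ = 1 := by
    refine le_antisymm hx₀ ?_
    have h1 := g.le_of_opNorm_le hg1 x₀
    rwa [hgx₀, norm_one, one_mul] at h1
  refine ⟨T₀, x₀, φ₀, le_antisymm hT₀ ?_, hx₀1, ?_, ?_, ?_, ?_, ?_, ?_⟩
  · have h1 := g.le_of_opNorm_le hg1 (T₀ x₀)
    have h2 := T₀.le_opNorm x₀
    rw [hgT₀, norm_one, one_mul] at h1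
    rw [hx₀1, mul_one] at h2
    exact h1.trans h2
  · obtain ⟨γ, hγ⟩ : ∃ γ, x₀ γ ≠ 0 := by
      by_contra! hc
      have hz : x₀ = 0 := lp.ext (funext hc)
      simp [hz] at hgx₀
    have h1 := (hsupp γ hγ).1
    rw [hf] at h1
    refine le_antisymm (lp.norm_le_of_forall_le' 1 fun η => by rw [hφ₀]; exact hν1 η) ?_
    have h2 := lp.norm_apply_le_norm (by simp) φ₀ γ
    rwa [hφ₀, hφν γ h1, h1] at h2
  · simpa only [hφ₀, hg_apply] using hgx₀
  · refine LpOne.opNorm_le_of_single _ hε0.le fun γ => ?_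
    rw [_root_.sub_apply, hT₀s]
    exact hTs γ
  · have h1 : q ^ 4 / q ^ 3 = q := by field_simp
    rw [h1] at hxx₀
    linarith
  · refine lp.norm_le_of_forall_le' ε fun γ => ?_
    rw [lp.coeFn_sub, Pi.sub_apply, hφ₀]
    exact (hν γ).trans (by linarith)
  · simpa only [hφ₀, hg_apply] using hgT₀
end

section
/- Let Γ be a nonempty set and 𝕂 ∈ {ℝ, ℂ}. Suppose T : ℓ₁(Γ, 𝕂) → ℓ₁(Γ, 𝕂) is a bounded linear operator with ‖T‖ = 1 which is the adjoint of a bounded linear operator on c₀(Γ, 𝕂), let 0 < ε < 1, and let (x, φ) ∈ Π(ℓ₁(Γ, 𝕂)) with φ ∈ c₀(Γ, 𝕂) be such that Re(φ(Tx)) ≥ 1 − (ε/9)^{9/2}. Then the operator T₀ and the pair (x₀, φ₀) ∈ Π(ℓ₁(Γ, 𝕂)) with ‖T₀‖ = 1, ‖T − T₀‖ ≤ ε, ‖x − x₀‖ ≤ ε, ‖φ − φ₀‖ ≤ ε and φ₀(T₀ x₀) = 1 can be chosen so that T₀ is the adjoint of a bounded linear operator on c₀(Γ, 𝕂) and φ₀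 ∈ c₀(Γ, 𝕂). -/
open scoped ENNReal ZeroAtInfty
open Filter

namespace BPBNumericalRadius

variable {Γ 𝕂 : Type*} [RCLike 𝕂]

lemma norm_eq_tsum (v : lp (fun _ : Γ => 𝕂) 1) : ‖v‖ = ∑' γ, ‖v γ‖ := by
  rw [lp.norm_eq_tsum_rpow (by simp)]
  simp

lemma summable_norm (v : lp (fun _ : Γ => 𝕂) 1) : Summable fun γ => ‖v γ‖ := by
  simpa using (lp.memℓp v).summable (by simp)

/-- The duality pairing `⟨φ, v⟩ = ∑ φ γ * v γ` between `ℓ∞` and `ℓ₁`. -/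
noncomputable def pairing (Γ 𝕂 : Type*) [RCLike 𝕂] :
    lp (fun _ : Γ => 𝕂) ∞ →L[𝕂] lp (fun _ : Γ => 𝕂) 1 →L[𝕂] 𝕂 :=
  lp.dualPairing ∞ 1 (fun _ => ContinuousLinearMap.mul 𝕂 𝕂) (K := 1) (by simp)

lemma pairing_apply (φ : lp (fun _ : Γ => 𝕂) ∞) (v : lp (fun _ : Γ => 𝕂) 1) :
    pairing Γ 𝕂 φ v = ∑' γ, φ γ * v γ := rfl

lemma norm_pairing_apply_le (φ : lp (fun _ : Γ => 𝕂) ∞) (v : lp (fun _ : Γ => 𝕂) 1) :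
    ‖pairing Γ 𝕂 φ v‖ ≤ ‖φ‖ * ‖v‖ := by
  have h : ‖pairing Γ 𝕂‖ ≤ 1 := lp.norm_dualPairing _ _
  calc ‖pairing Γ 𝕂 φ v‖ ≤ ‖pairing Γ 𝕂‖ * ‖φ‖ * ‖v‖ := ContinuousLinearMap.le_opNorm₂ _ _ _
    _ ≤ 1 * ‖φ‖ * ‖v‖ := by gcongr
    _ = ‖φ‖ * ‖v‖ := by ring

lemma norm_coord_le (φ : lp (fun _ : Γ => 𝕂) ∞) (γ : Γ) : ‖φ γ‖ ≤ ‖φ‖ :=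
  lp.norm_apply_le_norm (by simp) φ γ

lemma summable_pairing (φ : lp (fun _ : Γ => 𝕂) ∞) (v : lp (fun _ : Γ => 𝕂) 1) :
    Summable fun γ => φ γ * v γ := by
  refine Summable.of_norm_bounded ((summable_norm v).mul_left ‖φ‖) fun γ => ?_
  rw [norm_mul]
  gcongr
  exact norm_coord_le φ γ

lemma pairing_single [DecidableEq Γ] (φ : lp (fun _ : Γ => 𝕂) ∞) (γ : Γ) (a : 𝕂) :
    pairing Γ 𝕂 φ (lp.single 1 γ a) = φ γ * a := by
  rw [pairing_apply, tsum_eq_single γ]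
  · simp
  · intro β hβ
    simp [hβ]

/-- The inclusion of `c₀` into `ℓ∞`. -/
noncomputable def inclusion (Γ 𝕂 : Type*) [RCLike 𝕂] [TopologicalSpace Γ] :
    C₀(Γ, 𝕂) →L[𝕂] lp (fun _ : Γ => 𝕂) ∞ :=
  LinearMap.mkContinuous
    { toFun := fun y => ⟨fun γ => y γ, memℓp_infty ⟨‖y‖, by
        rintro _ ⟨γ, rfl⟩
        exact y.toBCF.norm_coe_le_norm γ⟩⟩
      map_add' := fun _ _ => rfl
      map_smul' := fun _ _ => rfl } 1 fun y => by
        rw [one_mul]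
        exact lp.norm_le_of_forall_le (norm_nonneg _) fun γ => y.toBCF.norm_coe_le_norm γ

lemma inclusion_apply [TopologicalSpace Γ] (y : C₀(Γ, 𝕂)) (γ : Γ) :
    inclusion Γ 𝕂 y γ = y γ := rfl

/-- The indicator function of a point, as an element of `c₀`. -/
noncomputable def pointMass [DecidableEq Γ] [TopologicalSpace Γ] [DiscreteTopology Γ] (γ : Γ) :
    C₀(Γ, 𝕂) where
  toFun := Pi.single γ 1
  continuous_toFun := continuous_of_discreteTopology
  zero_at_infty' := by
    rw [cocompact_eq_cofinite]
    refine tendsto_const_nhds.congr' ?_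
    filter_upwards [(Set.finite_singleton γ).compl_mem_cofinite] with β hβ
    simp_all

lemma pairing_pointMass [DecidableEq Γ] [TopologicalSpace Γ] [DiscreteTopology Γ]
    (ψ : lp (fun _ : Γ => 𝕂) 1) (γ : Γ) :
    pairing Γ 𝕂 (inclusion Γ 𝕂 (pointMass γ)) ψ = ψ γ := by
  rw [pairing_apply, tsum_eq_single γ]
  · simp [inclusion_apply, pointMass]
  · intro β hβ
    simp [inclusion_apply, pointMass, hβ]

lemma norm_sub_sum_single [DecidableEq Γ] (ψ : lp (fun _ : Γ => 𝕂) 1) (G : Finset Γ) :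
    ‖ψ - ∑ γ ∈ G, lp.single 1 γ (ψ γ)‖ = ‖ψ‖ - ∑ γ ∈ G, ‖ψ γ‖ := by
  have := lp.norm_compl_sum_single (p := 1) (by simp) ψ G
  simpa using this

lemma norm_sum_single [DecidableEq Γ] (f : Γ → 𝕂) (G : Finset Γ) :
    ‖∑ γ ∈ G, lp.single (E := fun _ : Γ => 𝕂) 1 γ (f γ)‖ = ∑ γ ∈ G, ‖f γ‖ := by
  have := lp.norm_sum_single (p := 1) (E := fun _ : Γ => 𝕂) (by simp) f G
  simpa using this

/-- Replacing finitely many columns of an operator on `ℓ₁` preserves being an adjoint. -/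
lemma exists_replace_columns [DecidableEq Γ] [TopologicalSpace Γ] [DiscreteTopology Γ]
    (T : lp (fun _ : Γ => 𝕂) 1 →L[𝕂] lp (fun _ : Γ => 𝕂) 1) (hT : ‖T‖ ≤ 1)
    (S : C₀(Γ, 𝕂) →L[𝕂] C₀(Γ, 𝕂))
    (hTS : ∀ (ψ : lp (fun _ : Γ => 𝕂) 1) (y : C₀(Γ, 𝕂)),
      (∑' γ : Γ, (T ψ) γ * y γ) = ∑' γ : Γ, ψ γ * (S y) γ)
    {ε : ℝ} (hε : 0 ≤ ε) (G : Finset Γ) (w : Γ → lp (fun _ : Γ => 𝕂) 1)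
    (hw : ∀ γ ∈ G, ‖w γ‖ ≤ 1) (hTw : ∀ γ ∈ G, ‖T (lp.single 1 γ 1) - w γ‖ ≤ ε) :
    ∃ T₀ : lp (fun _ : Γ => 𝕂) 1 →L[𝕂] lp (fun _ : Γ => 𝕂) 1,
      ‖T₀‖ ≤ 1 ∧ ‖T - T₀‖ ≤ ε ∧ (∀ γ ∈ G, T₀ (lp.single 1 γ 1) = w γ) ∧
      ∃ S₀ : C₀(Γ, 𝕂) →L[𝕂] C₀(Γ, 𝕂),
        ∀ (ψ : lp (fun _ : Γ => 𝕂) 1) (y : C₀(Γ, 𝕂)),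
          (∑' γ : Γ, (T₀ ψ) γ * y γ) = ∑' γ : Γ, ψ γ * (S₀ y) γ := by
  let D : Γ → lp (fun _ : Γ => 𝕂) 1 := fun γ => w γ - T (lp.single 1 γ 1)
  let T₀ : lp (fun _ : Γ => 𝕂) 1 →L[𝕂] lp (fun _ : Γ => 𝕂) 1 :=
    T + ∑ γ ∈ G, (lp.evalCLM 𝕂 (fun _ : Γ => 𝕂) 1 γ).smulRight (D γ)
  have hT₀ (ψ) : T₀ ψ = T ψ + ∑ γ ∈ G, ψ γ • D γ := by
    simp [T₀, lp.evalCLM]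
  have hsum (ψ : lp (fun _ : Γ => 𝕂) 1) : ∑ γ ∈ G, ‖ψ γ‖ ≤ ‖ψ‖ := by
    have := norm_nonneg (ψ - ∑ γ ∈ G, lp.single 1 γ (ψ γ))
    rw [norm_sub_sum_single] at this
    linarith
  have hsingle (γ : Γ) (a : 𝕂) :
      lp.single (E := fun _ : Γ => 𝕂) 1 γ a = a • lp.single (E := fun _ : Γ => 𝕂) 1 γ 1 := by
    rw [← lp.single_smul]; simp
  refine ⟨T₀, ?_, ?_, ?_, ?_⟩
  · refine ContinuousLinearMap.opNorm_le_bound _ zero_le_one fun ψ => ?_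
    have h : T₀ ψ = T (ψ - ∑ γ ∈ G, lp.single 1 γ (ψ γ)) + ∑ γ ∈ G, ψ γ • w γ := by
      rw [hT₀, map_sub, map_sum]
      simp_rw [D, smul_sub, Finset.sum_sub_distrib, hsingle _ (ψ _), map_smul]
      abel
    rw [h, one_mul]
    have h1 : ‖T (ψ - ∑ γ ∈ G, lp.single 1 γ (ψ γ))‖ ≤ ‖ψ‖ - ∑ γ ∈ G, ‖ψ γ‖ := by
      rw [← norm_sub_sum_single]
      exact (T.le_of_opNorm_le hT _).trans_eq (one_mul _)
    have h2 : ‖∑ γ ∈ G, ψ γ • w γ‖ ≤ ∑ γ ∈ G, ‖ψ γ‖ := by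
      refine norm_sum_le_of_le _ fun γ hγ => ?_
      rw [norm_smul]
      exact mul_le_of_le_one_right (norm_nonneg _) (hw γ hγ)
    linarith [norm_add_le (T (ψ - ∑ γ ∈ G, lp.single 1 γ (ψ γ))) (∑ γ ∈ G, ψ γ • w γ)]
  · refine ContinuousLinearMap.opNorm_le_bound _ hε fun ψ => ?_
    rw [sub_apply, hT₀, sub_add_cancel_left, norm_neg]
    calc ‖∑ γ ∈ G, ψ γ • D γ‖ ≤ ∑ γ ∈ G, ‖ψ γ‖ * ε := by
          refine norm_sum_le_of_le _ fun γ hγ => ?_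
          rw [norm_smul, ← norm_neg (D γ), neg_sub]
          gcongr
          exact hTw γ hγ
      _ = ε * ∑ γ ∈ G, ‖ψ γ‖ := by rw [← Finset.sum_mul, mul_comm]
      _ ≤ ε * ‖ψ‖ := by gcongr; exact hsum ψ
  · intro γ hγ
    rw [hT₀, Finset.sum_eq_single_of_mem γ hγ]
    · simp [D]
    · intro β _ hβ
      simp [hβ]
  · let S₀ : C₀(Γ, 𝕂) →L[𝕂] C₀(Γ, 𝕂) :=
      S + ∑ γ ∈ G, (((pairing Γ 𝕂).flip (D γ)).comp (inclusion Γ 𝕂)).smulRight (pointMass γ)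
    have key (ψ : lp (fun _ : Γ => 𝕂) 1) (y : C₀(Γ, 𝕂)) :
        ∑' γ, ψ γ * y γ = pairing Γ 𝕂 (inclusion Γ 𝕂 y) ψ := by
      rw [pairing_apply]
      exact tsum_congr fun γ => mul_comm _ _
    refine ⟨S₀, fun ψ y => ?_⟩
    have hS₀ : S₀ y = S y + ∑ γ ∈ G, pairing Γ 𝕂 (inclusion Γ 𝕂 y) (D γ) • pointMass γ := by
      simp [S₀]
    have hTS' := hTS ψ y
    rw [key, key] at hTS' ⊢
    rw [hT₀, hS₀, map_add, map_add, map_add, map_sum, map_sum, map_sum, add_apply, hTS',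
      sum_apply]
    simp_rw [map_smul, smul_apply, pairing_pointMass, smul_eq_mul, mul_comm]

lemma norm_sub_norm_smul_conj_le {ε r : ℝ} (hε : 0 < ε) (hr : 1 / 2 ≤ r) (hr1 : r ≤ 1)
    {u v : 𝕂} (hu : ‖u‖ = 1) :
    ‖v - (‖v‖ : 𝕂) * starRingEnd 𝕂 u‖ ≤
      ε / 4 * ‖v‖ + 4 / ε * (‖v‖ - RCLike.re ((r : 𝕂) * u * v)) := by
  have hre : RCLike.re ((r : 𝕂) * u * v) = r * RCLike.re (u * v) := by
    rw [mul_assoc, RCLike.re_ofReal_mul]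
  have huv : RCLike.re (u * v) ≤ ‖v‖ := by
    simpa [hu] using RCLike.re_le_norm (u * v)
  have hsq : ‖v - (‖v‖ : 𝕂) * starRingEnd 𝕂 u‖ ^ 2 = 2 * ‖v‖ * (‖v‖ - RCLike.re (u * v)) := by
    have h1 : ‖u‖ ^ 2 = 1 := by rw [hu]; norm_num
    have h2 := RCLike.norm_sq_eq_def (K := 𝕂) (z := v)
    rw [RCLike.norm_sq_eq_def] at h1 ⊢
    simp only [map_sub, RCLike.re_ofReal_mul, RCLike.im_ofReal_mul, RCLike.conj_re,
      RCLike.conj_im]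
    rw [RCLike.mul_re]
    linear_combination ‖v‖ ^ 2 * h1 - h2
  have hv := norm_nonneg v
  set D := ‖v‖ - RCLike.re ((r : 𝕂) * u * v) with hD
  have hdD : ‖v‖ - RCLike.re (u * v) ≤ 2 * D := by rw [hD, hre]; nlinarith
  have hD0 : 0 ≤ D := by nlinarith
  refine abs_le_of_sq_le_sq' ?_ (by positivity) |>.2
  rw [hsq]
  have h4 : (ε / 4 * ‖v‖) * (4 / ε * D) = ‖v‖ * D := by field_simp
  nlinarith [sq_nonneg (ε / 4 * ‖v‖ - 4 / ε * D), mul_le_mul_of_nonneg_left hdD hv]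

/-- A vector of `ℓ₁` that almost norms `φ` is close to a vector on which `φ₀` attains the
value `1`. -/
lemma exists_close_attaining [DecidableEq Γ] {ε : ℝ} (hε0 : 0 < ε) (hε1 : ε < 1)
    (φ φ₀ : lp (fun _ : Γ => 𝕂) ∞) (hφ : ‖φ‖ ≤ 1) (B : Finset Γ) {b : Γ} (hb : b ∈ B)
    (hB : ∀ β ∈ B, 1 - ε / 2 ≤ ‖φ β‖) (hB' : ∀ β ∉ B, ‖φ β‖ ≤ 1 - ε / 2)
    (hφ₀ : ∀ β ∈ B, ‖φ₀ β‖ = 1 ∧ φ β = (‖φ β‖ : 𝕂) * φ₀ β)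
    (v : lp (fun _ : Γ => 𝕂) 1) (hv : ‖v‖ ≤ 1)
    (hφv : 1 - ε ^ 2 / 18 ≤ RCLike.re (pairing Γ 𝕂 φ v)) :
    ∃ w : lp (fun _ : Γ => 𝕂) 1, ‖w‖ ≤ 1 ∧ pairing Γ 𝕂 φ₀ w = 1 ∧ ‖v - w‖ ≤ ε := by
  let w₁ : lp (fun _ : Γ => 𝕂) 1 :=
    ∑ β ∈ B, lp.single 1 β ((‖v β‖ : 𝕂) * starRingEnd 𝕂 (φ₀ β))
  have hw₁ (γ : Γ) : w₁ γ = if γ ∈ B then (‖v γ‖ : 𝕂) * starRingEnd 𝕂 (φ₀ γ) else 0 := by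
    have h := map_sum (lp.evalCLM 𝕂 (fun _ : Γ => 𝕂) 1 γ)
      (fun β => lp.single 1 β ((‖v β‖ : 𝕂) * starRingEnd 𝕂 (φ₀ β))) B
    refine h.trans ?_
    simp [lp.evalCLM, Pi.single_apply]
  set m := ∑ β ∈ B, ‖v β‖ with hm
  have hw₁m : ‖w₁‖ = m := by
    rw [norm_sum_single]
    refine Finset.sum_congr rfl fun β hβ => ?_
    simp [(hφ₀ β hβ).1]
  have hm1 : m ≤ 1 := by
    have := norm_nonneg (v - ∑ γ ∈ B, lp.single 1 γ (v γ))
    rw [norm_sub_sum_single] at this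
    linarith
  have hunit (β : Γ) (hβ : β ∈ B) : φ₀ β * starRingEnd 𝕂 (φ₀ β) = 1 := by
    rw [RCLike.mul_conj, (hφ₀ β hβ).1]; simp
  have hpair : pairing Γ 𝕂 φ₀ w₁ = (m : 𝕂) := by
    simp only [w₁, map_sum, pairing_single, hm]
    refine Finset.sum_congr rfl fun β hβ => ?_
    rw [mul_left_comm, hunit β hβ, mul_one]
  have hpt (γ : Γ) : ‖(v - w₁) γ‖ ≤
      ε / 4 * ‖v γ‖ + 4 / ε * (‖v γ‖ - RCLike.re (φ γ * v γ)) := by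
    rw [lp.coeFn_sub, Pi.sub_apply, hw₁]
    by_cases hγ : γ ∈ B
    · rw [if_pos hγ, (hφ₀ γ hγ).2]
      exact norm_sub_norm_smul_conj_le hε0 (by linarith [hB γ hγ])
        ((norm_coord_le φ γ).trans hφ) (hφ₀ γ hγ).1
    · rw [if_neg hγ, sub_zero]
      have h1 : RCLike.re (φ γ * v γ) ≤ (1 - ε / 2) * ‖v γ‖ := by
        refine (RCLike.re_le_norm _).trans ?_
        rw [norm_mul]
        exact mul_le_mul_of_nonneg_right (hB' γ hγ) (norm_nonneg _)
      have h2 : 4 / ε * (ε / 2 * ‖v γ‖) ≤ 4 / ε * (‖v γ‖ - RCLike.re (φ γ * v γ)) := by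
        gcongr
        linarith
      have h3 : 4 / ε * (ε / 2 * ‖v γ‖) = 2 * ‖v γ‖ := by field_simp; norm_num
      have h4 : 0 ≤ ε / 4 * ‖v γ‖ := by positivity
      linarith [norm_nonneg (v γ)]
  have hre : HasSum (fun γ => RCLike.re (φ γ * v γ)) (RCLike.re (pairing Γ 𝕂 φ v)) :=
    (RCLike.reCLM (K := 𝕂)).hasSum (summable_pairing φ v).hasSum
  have hnv : HasSum (fun γ => ‖v γ‖) ‖v‖ := by
    rw [norm_eq_tsum]; exact (summable_norm v).hasSum
  have hvw₁ : ‖v - w₁‖ ≤ ε / 4 * ‖v‖ + 4 / ε * (‖v‖ - RCLike.re (pairing Γ 𝕂 φ v)) := by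
    have h := (summable_norm (v - w₁)).hasSum
    rw [← norm_eq_tsum] at h
    exact hasSum_le hpt h ((hnv.mul_left _).add ((hnv.sub hre).mul_left _))
  have hvre : 1 - ε ^ 2 / 18 ≤ ‖v‖ := by
    refine hφv.trans ((RCLike.re_le_norm _).trans ((norm_pairing_apply_le φ v).trans ?_))
    exact mul_le_of_le_one_left (norm_nonneg _) hφ
  have hvw₁' : ‖v - w₁‖ ≤ 17 * ε / 36 := by
    have h1 : 4 / ε * (‖v‖ - RCLike.re (pairing Γ 𝕂 φ v)) ≤ 4 / ε * (ε ^ 2 / 18) := by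
      gcongr
      linarith
    have h2 : 4 / ε * (ε ^ 2 / 18) = 2 * ε / 9 := by field_simp; norm_num
    nlinarith
  have hm' : ‖v‖ ≤ m + 17 * ε / 36 := by
    have := norm_sub_norm_le v w₁
    linarith
  let w₂ : lp (fun _ : Γ => 𝕂) 1 :=
    lp.single 1 b (((1 - m : ℝ) : 𝕂) * starRingEnd 𝕂 (φ₀ b))
  have hw₂ : ‖w₂‖ = 1 - m := by
    rw [lp.norm_single (by simp), norm_mul, RCLike.norm_conj, (hφ₀ b hb).1, mul_one,
      RCLike.norm_of_nonneg (by linarith)]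
  refine ⟨w₁ + w₂, ?_, ?_, ?_⟩
  · linarith [norm_add_le w₁ w₂]
  · rw [map_add, hpair, pairing_single, mul_left_comm, hunit b hb]
    push_cast
    ring
  · rw [← sub_sub]
    have := norm_sub_le (v - w₁) w₂
    nlinarith

/-- Pairs in `Π(ℓ₁)` are aligned coordinatewise. -/
lemma aligned_of_pairing_eq_one {x : lp (fun _ : Γ => 𝕂) 1} {φ : lp (fun _ : Γ => 𝕂) ∞}
    (hx : ‖x‖ = 1) (hφ : ‖φ‖ ≤ 1) (hxφ : pairing Γ 𝕂 φ x = 1) (γ : Γ) :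
    (x γ = 0 ∨ ‖φ γ‖ = 1) ∧ φ γ * x γ = (‖x γ‖ : 𝕂) ∧
      x γ = (‖x γ‖ : 𝕂) * starRingEnd 𝕂 (φ γ) := by
  have hle (β : Γ) : ‖φ β * x β‖ ≤ ‖x β‖ := by
    rw [norm_mul]
    exact mul_le_of_le_one_left (norm_nonneg _) ((norm_coord_le φ β).trans hφ)
  have hre : HasSum (fun β => RCLike.re (φ β * x β)) (RCLike.re (pairing Γ 𝕂 φ x)) :=
    (RCLike.reCLM (K := 𝕂)).hasSum (summable_pairing φ x).hasSum
  have hnx : HasSum (fun β => ‖x β‖) ‖x‖ := by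
    rw [norm_eq_tsum]; exact (summable_norm x).hasSum
  have h0 := hnx.sub hre
  rw [hx, hxφ, RCLike.one_re, sub_self, hasSum_zero_iff_of_nonneg
    fun β => sub_nonneg.2 ((RCLike.re_le_norm _).trans (hle β))] at h0
  have hγ : ‖x γ‖ = RCLike.re (φ γ * x γ) := sub_eq_zero.1 (congrFun h0 γ)
  have hnorm : ‖φ γ * x γ‖ = ‖x γ‖ :=
    (hle γ).antisymm (hγ.trans_le (RCLike.re_le_norm _))
  have hmul : φ γ * x γ = (‖x γ‖ : 𝕂) := by
    have : RCLike.re (φ γ * x γ) = ‖φ γ * x γ‖ := by rw [hnorm, hγ]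
    rw [← hnorm]
    exact (RCLike.norm_le_re_iff_eq_norm.1 this.ge)
  have hor : x γ = 0 ∨ ‖φ γ‖ = 1 := by
    rw [or_iff_not_imp_left]
    intro h
    rw [norm_mul] at hnorm
    exact mul_right_cancel₀ (norm_ne_zero_iff.2 h) (hnorm.trans (one_mul _).symm)
  refine ⟨hor, hmul, ?_⟩
  rcases hor with h | h
  · simp [h]
  · rw [← hmul, mul_right_comm, RCLike.mul_conj, h]
    simp

/-- A functional vanishing at infinity can be made unimodular where its modulus is nearly one. -/
lemma exists_unimodular_modification {ε : ℝ} (hε0 : 0 < ε) (hε1 : ε < 1)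
    (φ : lp (fun _ : Γ => 𝕂) ∞) (hφ : ‖φ‖ ≤ 1)
    (hφ0 : Tendsto (fun γ : Γ => φ γ) cofinite (nhds 0)) :
    ∃ (B : Finset Γ) (φ₀ : lp (fun _ : Γ => 𝕂) ∞),
      (∀ β ∈ B, 1 - ε / 2 ≤ ‖φ β‖) ∧ (∀ β ∉ B, ‖φ β‖ ≤ 1 - ε / 2) ∧
      (∀ β ∈ B, ‖φ₀ β‖ = 1 ∧ φ β = (‖φ β‖ : 𝕂) * φ₀ β) ∧
      ‖φ₀‖ ≤ 1 ∧ ‖φ - φ₀‖ ≤ ε ∧ Tendsto (fun γ : Γ => φ₀ γ) cofinite (nhds 0) := by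
  classical
  have hfin : {β | 1 - ε / 2 ≤ ‖φ β‖}.Finite := by
    have h := hφ0.norm.eventually_lt_const (u := 1 - ε / 2) (by simp; linarith)
    simpa using h
  let B := hfin.toFinset
  have hB (β : Γ) : β ∈ B ↔ 1 - ε / 2 ≤ ‖φ β‖ := by simp [B]
  let f : Γ → 𝕂 := fun β => if β ∈ B then ((‖φ β‖⁻¹ : ℝ) : 𝕂) * φ β else φ β
  have hfB (β : Γ) (hβ : β ∈ B) : ‖f β‖ = 1 ∧ φ β = (‖φ β‖ : 𝕂) * f β := by
    have h0 : ‖φ β‖ ≠ 0 := by linarith [(hB β).1 hβ]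
    simp only [f, if_pos hβ]
    constructor
    · rw [norm_mul, RCLike.norm_of_nonneg (by positivity), inv_mul_cancel₀ h0]
    · rw [← mul_assoc, ← RCLike.ofReal_mul, mul_inv_cancel₀ h0]
      simp
  have hf1 (β : Γ) : ‖f β‖ ≤ 1 := by
    by_cases hβ : β ∈ B
    · exact (hfB β hβ).1.le
    · simp only [f, if_neg hβ]
      exact (norm_coord_le φ β).trans hφ
  let φ₀ : lp (fun _ : Γ => 𝕂) ∞ := ⟨f, memℓp_infty ⟨1, by rintro _ ⟨β, rfl⟩; exact hf1 β⟩⟩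
  refine ⟨B, φ₀, fun β => (hB β).1, fun β hβ => (not_le.1 (mt (hB β).2 hβ)).le, hfB,
    lp.norm_le_of_forall_le zero_le_one hf1, lp.norm_le_of_forall_le hε0.le fun β => ?_, ?_⟩
  · change ‖φ β - f β‖ ≤ ε
    by_cases hβ : β ∈ B
    · obtain ⟨h1, h2⟩ := hfB β hβ
      have h3 : φ β - f β = ((‖φ β‖ - 1 : ℝ) : 𝕂) * f β := by
        conv_lhs => rw [h2]
        push_cast
        ring
      rw [h3, norm_mul, h1, mul_one, RCLike.norm_ofReal, abs_le]
      constructor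
      · linarith [(hB β).1 hβ]
      · linarith [(norm_coord_le φ β).trans hφ]
    · simp [f, if_neg hβ, hε0.le]
  · refine hφ0.congr' ?_
    filter_upwards [B.finite_toSet.compl_mem_cofinite] with β hβ
    exact (if_neg (by simpa using hβ)).symm

/-- Truncating and normalizing a vector of `ℓ₁`. -/
lemma norm_sub_normalized_truncation [DecidableEq Γ] (x : lp (fun _ : Γ => 𝕂) 1) (hx : ‖x‖ = 1)
    (G : Finset Γ) (hG : 0 < ∑ γ ∈ G, ‖x γ‖) :
    ‖x - (((∑ γ ∈ G, ‖x γ‖)⁻¹ : ℝ) : 𝕂) • ∑ γ ∈ G, lp.single 1 γ (x γ)‖ ≤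
      2 * (1 - ∑ γ ∈ G, ‖x γ‖) := by
  set m := ∑ γ ∈ G, ‖x γ‖ with hm
  set y := ∑ γ ∈ G, lp.single (E := fun _ : Γ => 𝕂) 1 γ (x γ) with hy
  have h1 : ‖x - y‖ = 1 - m := by rw [hy, norm_sub_sum_single, hx]
  have hm1 : 0 ≤ 1 - m := h1 ▸ norm_nonneg _
  have hym : ‖y‖ = m := norm_sum_single _ _
  have h2 : y - ((m⁻¹ : ℝ) : 𝕂) • y = ((1 - m⁻¹ : ℝ) : 𝕂) • y := by
    push_cast
    rw [sub_smul, one_smul]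
  have h3 : ‖y - ((m⁻¹ : ℝ) : 𝕂) • y‖ = 1 - m := by
    rw [h2, norm_smul, hym, RCLike.norm_ofReal, abs_of_nonpos]
    · field_simp
      ring
    · have := one_le_inv_iff₀.2 ⟨hG, by linarith⟩
      linarith
  linarith [norm_sub_le_norm_sub_add_norm_sub x y (((m⁻¹ : ℝ) : 𝕂) • y)]

/-- If an average of the numbers `1 - g γ` with weights `‖x γ‖` is small, most of the mass
of `x` sits where `1 - g γ` is small. -/
lemma one_sub_le_sum_norm {x : lp (fun _ : Γ => 𝕂) 1} (hx : ‖x‖ = 1) (g : Γ → ℝ) {s δ δ' : ℝ}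
    (hδ' : 0 < δ') (hg : ∀ γ, ‖x γ‖ * g γ ≤ ‖x γ‖) (hs : HasSum (fun γ => ‖x γ‖ * g γ) s)
    (hsδ : 1 - δ ≤ s) (G : Finset Γ) (hG : ∀ γ ∉ G, ‖x γ‖ * g γ ≤ ‖x γ‖ * (1 - δ')) :
    1 - δ / δ' ≤ ∑ γ ∈ G, ‖x γ‖ := by
  classical
  have hnx : HasSum (fun β => ‖x β‖) 1 := by
    rw [← hx, norm_eq_tsum]; exact (summable_norm x).hasSum
  have hGs : HasSum (fun γ => if γ ∈ G then ‖x γ‖ else 0) (∑ γ ∈ G, ‖x γ‖) := by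
    have := (hasSum_sum_of_ne_finset_zero fun γ hγ => if_neg hγ :
      HasSum (fun γ => if γ ∈ G then ‖x γ‖ else 0) _)
    rwa [Finset.sum_congr rfl fun γ hγ => if_pos hγ] at this
  have h := hasSum_le (fun γ => ?_) ((hnx.sub hGs).mul_left δ') (hnx.sub hs)
  · have h' : 1 - ∑ γ ∈ G, ‖x γ‖ ≤ δ / δ' := by
      rw [le_div_iff₀ hδ']
      linarith
    linarith
  · by_cases hγ : γ ∈ G
    · simpa [hγ] using hg γ
    · have := hG γ hγ
      simp only [if_neg hγ]
      linarith

end BPBNumericalRadius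

open BPBNumericalRadius

/-- Refined version: if moreover `T` is weak*-weak*-continuous (i.e. the adjoint
of a bounded operator on `c₀(Γ, 𝕂)`, expressed through the duality pairing) and
`φ` is weak*-continuous (i.e. lies in `c₀(Γ, 𝕂)`, expressed as vanishing at
infinity), then `T₀` and `φ₀` can be chosen to be an adjoint of an operator on
`c₀(Γ, 𝕂)` and in `c₀(Γ, 𝕂)`, respectively. -/
theorem bpb_numerical_radius_l1_general_weak_star
    (Γ : Type*) [Nonempty Γ] [TopologicalSpace Γ] [DiscreteTopology Γ]
    (𝕂 : Type*) [RCLike 𝕂]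
    (T : lp (fun _ : Γ => 𝕂) 1 →L[𝕂] lp (fun _ : Γ => 𝕂) 1) (hT : ‖T‖ = 1)
    (S : C₀(Γ, 𝕂) →L[𝕂] C₀(Γ, 𝕂))
    (hTS : ∀ (ψ : lp (fun _ : Γ => 𝕂) 1) (y : C₀(Γ, 𝕂)),
      (∑' γ : Γ, (T ψ) γ * y γ) = ∑' γ : Γ, ψ γ * (S y) γ)
    (ε : ℝ) (hε0 : 0 < ε) (hε1 : ε < 1)
    (x : lp (fun _ : Γ => 𝕂) 1) (φ : lp (fun _ : Γ => 𝕂) ∞)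
    (hx : ‖x‖ = 1) (hφ : ‖φ‖ = 1) (hxφ : (∑' γ : Γ, φ γ * x γ) = 1)
    (hφc0 : Tendsto (fun γ : Γ => φ γ) (cocompact Γ) (nhds 0))
    (hnum : 1 - (ε / 9) ^ ((9 : ℝ) / 2) ≤ RCLike.re (∑' γ : Γ, φ γ * (T x) γ)) :
    ∃ (T₀ : lp (fun _ : Γ => 𝕂) 1 →L[𝕂] lp (fun _ : Γ => 𝕂) 1)
      (x₀ : lp (fun _ : Γ => 𝕂) 1) (φ₀ : lp (fun _ : Γ => 𝕂) ∞),
      ‖T₀‖ = 1 ∧ ‖x₀‖ = 1 ∧ ‖φ₀‖ = 1 ∧ (∑' γ : Γ, φ₀ γ * x₀ γ) = 1 ∧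
      ‖T - T₀‖ ≤ ε ∧ ‖x - x₀‖ ≤ ε ∧ ‖φ - φ₀‖ ≤ ε ∧
      (∑' γ : Γ, φ₀ γ * (T₀ x₀) γ) = 1 ∧
      (∃ S₀ : C₀(Γ, 𝕂) →L[𝕂] C₀(Γ, 𝕂),
        ∀ (ψ : lp (fun _ : Γ => 𝕂) 1) (y : C₀(Γ, 𝕂)),
          (∑' γ : Γ, (T₀ ψ) γ * y γ) = ∑' γ : Γ, ψ γ * (S₀ y) γ) ∧
      Tendsto (fun γ : Γ => φ₀ γ) (cocompact Γ) (nhds 0) := by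
  classical
  rw [cocompact_eq_cofinite] at hφc0 ⊢
  rw [← pairing_apply] at hxφ hnum
  obtain ⟨B, φ₀, hB, hB', hφ₀B, hφ₀1, hφφ₀, hφ₀c0⟩ :=
    exists_unimodular_modification hε0 hε1 φ hφ.le hφc0
  have halign := aligned_of_pairing_eq_one hx hφ.le hxφ
  let v : Γ → lp (fun _ : Γ => 𝕂) 1 := fun γ => T (lp.single 1 γ (starRingEnd 𝕂 (φ γ)))
  let g : Γ → ℝ := fun γ => RCLike.re (pairing Γ 𝕂 φ (v γ))
  have hv (γ : Γ) : ‖v γ‖ ≤ 1 := by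
    refine (T.le_opNorm _).trans ?_
    rw [hT, one_mul, lp.norm_single (by simp), RCLike.norm_conj, ← hφ]
    exact norm_coord_le φ γ
  have hg (γ : Γ) : g γ ≤ 1 := by
    refine (RCLike.re_le_norm _).trans ((norm_pairing_apply_le φ (v γ)).trans ?_)
    rw [hφ, one_mul]
    exact hv γ
  have hs : HasSum (fun γ => ‖x γ‖ * g γ) (RCLike.re (pairing Γ 𝕂 φ (T x))) := by
    have h := (RCLike.reCLM (K := 𝕂)).hasSum
      (((pairing Γ 𝕂 φ).comp T).hasSum (lp.hasSum_single (by simp) x))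
    convert! h using 2 with γ
    have hxγ : lp.single (E := fun _ : Γ => 𝕂) 1 γ (x γ) =
        (‖x γ‖ : 𝕂) • lp.single 1 γ (starRingEnd 𝕂 (φ γ)) := by
      rw [← lp.single_smul, smul_eq_mul, ← (halign γ).2.2]
    rw [hxγ, map_smul, smul_eq_mul]
    exact (RCLike.re_ofReal_mul _ _).symm
  let G := B.filter fun γ => ‖φ γ‖ = 1 ∧ 1 - ε ^ 2 / 18 ≤ g γ
  have hδ : (ε / 9) ^ ((9 : ℝ) / 2) ≤ ε ^ 3 / 36 := by
    calc (ε / 9) ^ ((9 : ℝ) / 2) ≤ (ε / 9) ^ (3 : ℝ) :=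
          Real.rpow_le_rpow_of_exponent_ge (by positivity) (by linarith) (by norm_num)
      _ = (ε / 9) ^ 3 := by norm_cast
      _ ≤ ε ^ 3 / 36 := by nlinarith [pow_pos hε0 3]
  have hm : 1 - ε / 2 ≤ ∑ γ ∈ G, ‖x γ‖ := by
    have h := one_sub_le_sum_norm hx g (δ := ε ^ 3 / 36) (δ' := ε ^ 2 / 18) (by positivity)
      (fun γ => mul_le_of_le_one_right (norm_nonneg _) (hg γ)) hs (by linarith) G ?_
    · convert! h using 2
      field_simp
      norm_num
    · intro γ hγ
      rcases (halign γ).1 with h0 | h1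
      · simp [h0]
      · refine mul_le_mul_of_nonneg_left ?_ (norm_nonneg _)
        have hγB : γ ∈ B := by
          by_contra h
          linarith [hB' γ h]
        by_contra! h
        exact hγ (Finset.mem_filter.2 ⟨hγB, h1, h.le⟩)
  have hm0 : 0 < ∑ γ ∈ G, ‖x γ‖ := by linarith
  obtain ⟨b, hbG⟩ : G.Nonempty := by
    by_contra h
    simp [Finset.not_nonempty_iff_eq_empty.1 h] at hm0
  have hφ₀φ (γ : Γ) (hγ : γ ∈ G) : φ₀ γ = φ γ := by
    obtain ⟨hγB, hγ1, -⟩ := Finset.mem_filter.1 hγ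
    have := (hφ₀B γ hγB).2
    rw [hγ1] at this
    simpa using this.symm
  have hex (γ : Γ) (hγ : γ ∈ G) : ∃ w : lp (fun _ : Γ => 𝕂) 1,
      ‖w‖ ≤ 1 ∧ pairing Γ 𝕂 φ₀ w = 1 ∧ ‖v γ - w‖ ≤ ε :=
    exists_close_attaining hε0 hε1 φ φ₀ hφ.le B (Finset.mem_filter.1 hbG).1 hB hB' hφ₀B (v γ)
      (hv γ) (Finset.mem_filter.1 hγ).2.2
  choose! w hw1 hw2 hw3 using hex
  have hunit (γ : Γ) (hγ : γ ∈ G) : φ γ * starRingEnd 𝕂 (φ γ) = 1 := by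
    rw [RCLike.mul_conj, (Finset.mem_filter.1 hγ).2.1]
    simp
  have hTv (γ : Γ) (hγ : γ ∈ G) : T (lp.single 1 γ 1) = φ γ • v γ := by
    rw [← map_smul, ← lp.single_smul, smul_eq_mul, hunit γ hγ]
  obtain ⟨T₀, hT₀1, hTT₀, hT₀, hS₀⟩ := exists_replace_columns T hT.le S hTS hε0.le G
    (fun γ => φ γ • w γ)
    (fun γ hγ => by
      rw [norm_smul, (Finset.mem_filter.1 hγ).2.1, one_mul]
      exact hw1 γ hγ)
    (fun γ hγ => by
      rw [hTv γ hγ, ← smul_sub, norm_smul, (Finset.mem_filter.1 hγ).2.1, one_mul]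
      exact hw3 γ hγ)
  set m := ∑ γ ∈ G, ‖x γ‖ with hmdef
  let x₀ : lp (fun _ : Γ => 𝕂) 1 := ((m⁻¹ : ℝ) : 𝕂) • ∑ γ ∈ G, lp.single 1 γ (x γ)
  have hx₀ : ‖x₀‖ = 1 := by
    rw [norm_smul, norm_sum_single, RCLike.norm_of_nonneg (by positivity)]
    exact inv_mul_cancel₀ hm0.ne'
  have hmm : ((m⁻¹ : ℝ) : 𝕂) * (m : 𝕂) = 1 := by
    rw [← RCLike.ofReal_mul, inv_mul_cancel₀ hm0.ne', RCLike.ofReal_one]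
  have hφ₀x₀ : pairing Γ 𝕂 φ₀ x₀ = 1 := by
    rw [map_smul, map_sum, smul_eq_mul, ← hmm, hmdef, RCLike.ofReal_sum]
    congr 1
    refine Finset.sum_congr rfl fun γ hγ => ?_
    rw [pairing_single, hφ₀φ γ hγ, (halign γ).2.1]
  have hφ₀T₀x₀ : pairing Γ 𝕂 φ₀ (T₀ x₀) = 1 := by
    rw [map_smul, map_sum, map_smul, map_sum, smul_eq_mul, ← hmm, hmdef, RCLike.ofReal_sum]
    congr 1
    refine Finset.sum_congr rfl fun γ hγ => ?_
    have h : lp.single (E := fun _ : Γ => 𝕂) 1 γ (x γ) = x γ • lp.single 1 γ (1 : 𝕂) := by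
      rw [← lp.single_smul, smul_eq_mul, mul_one]
    rw [h, map_smul, hT₀ γ hγ, map_smul, map_smul, hw2 γ hγ, smul_eq_mul, smul_eq_mul, mul_one,
      mul_comm, (halign γ).2.1]
  have hone : 1 ≤ ‖φ₀‖ * ‖T₀‖ := by
    have h1 := norm_pairing_apply_le φ₀ (T₀ x₀)
    rw [hφ₀T₀x₀, norm_one] at h1
    have h2 := T₀.le_opNorm x₀
    rw [hx₀, mul_one] at h2
    exact h1.trans (by gcongr)
  have hT₀n : ‖T₀‖ = 1 := hT₀1.antisymm (by nlinarith [norm_nonneg T₀])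
  have hφ₀n : ‖φ₀‖ = 1 := hφ₀1.antisymm (by nlinarith [norm_nonneg φ₀])
  refine ⟨T₀, x₀, φ₀, hT₀n, hx₀, hφ₀n, hφ₀x₀, hTT₀, ?_, hφφ₀, hφ₀T₀x₀, hS₀, hφ₀c0⟩
  have := norm_sub_normalized_truncation x hx G hm0
  linarith
end
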